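/- For every agent i and every k ≥ 0, the quantized iterates stay uniformly close to the stopped-model limits: ‖x_iQ(k) − y(k)‖ ≤ 2(αL + √m/Q)(1 + nB/(β(1−β))), where β = 1 − η/(4n²). -/

import Mathlib

open scoped BigOperators RealInnerProductSpace
open Filter

/-- A square real matrix is doubly stochastic: nonnegative entries,
all row sums and all column sums equal to 1. -/
def IsDoublyStochastic {n : ℕ} (A : Matrix (Fin n) (Fin n) ℝ) : Prop :=
  (∀ i j, 0 ≤ A i j) ∧ (∀ i, ∑ j, A i j = 1) ∧ (∀ j, ∑ i, A i j = 1)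

/-- Assumption 1 (Weights): each `A k` is doubly stochastic with positive diagonal,
and every positive entry is at least `η`, where `η > 0`. -/
def WeightsAssumption {n : ℕ} (A : ℕ → Matrix (Fin n) (Fin n) ℝ) (η : ℝ) : Prop :=
  0 < η ∧ ∀ k, IsDoublyStochastic (A k) ∧ (∀ i, 0 < A k i i) ∧
    (∀ i j, 0 < A k i j → η ≤ A k i j)

/-- Assumption 2 (Connectivity): `B ≥ 1` and, for every `k`, the directed graph with an
edge from `j` to `i` whenever `[A t]_{i j} > 0` for some `t ∈ [kB, (k+1)B)` is strongly
connected (every vertex reaches every other vertex by a directed path). -/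
def ConnectivityAssumption {n : ℕ} (A : ℕ → Matrix (Fin n) (Fin n) ℝ) (B : ℕ) : Prop :=
  1 ≤ B ∧ ∀ k : ℕ, ∀ i j : Fin n,
    Relation.ReflTransGen
      (fun u v : Fin n => ∃ t : ℕ, k * B ≤ t ∧ t < (k + 1) * B ∧ 0 < A t v u) i j

/-- `g` is a subgradient of `f` at `x`. -/
def IsSubgradientAt {m : ℕ} (f : EuclideanSpace ℝ (Fin m) → ℝ)
    (g x : EuclideanSpace ℝ (Fin m)) : Prop :=
  ∀ y, f x + ⟪g, y - x⟫ ≤ f y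

/-- Some positive entry of `A` links `S` with its complement. -/
def Crosses {n : ℕ} (A : Matrix (Fin n) (Fin n) ℝ) (S : Finset (Fin n)) : Prop :=
  ∃ i j, 0 < A i j ∧ ¬(i ∈ S ↔ j ∈ S)

lemma sum_sq_gap_le {ι : Type*} [LinearOrder ι] {lo hi : ι → ℝ}
    (hle : ∀ d, lo d ≤ hi d) (hlt : ∀ d d', d < d' → hi d ≤ lo d') (F : Finset ι) {u : ℝ} :
    ∀ {v : ℝ}, u ≤ v → (∀ d ∈ F, u ≤ lo d) → (∀ d ∈ F, hi d ≤ v) →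
      ∑ d ∈ F, (hi d - lo d) ^ 2 ≤ (v - u) ^ 2 := by
  induction F using Finset.induction_on_max with
  | empty => intro v _ _ _; simpa using sq_nonneg (v - u)
  | insert a s hs ih =>
    intro v huv hu hv
    have ha : a ∉ s := fun h => lt_irrefl _ (hs a h)
    rw [Finset.sum_insert ha]
    have h1 := ih (hu a (Finset.mem_insert_self a s))
      (fun d hd => hu d (Finset.mem_insert_of_mem hd)) (fun d hd => hlt d a (hs d hd))
    have h2 := hu a (Finset.mem_insert_self a s)
    have h3 := hv a (Finset.mem_insert_self a s)
    have h4 := hle a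
    nlinarith [mul_nonneg (sub_nonneg.2 h2) (sub_nonneg.2 h4),
      mul_nonneg (sub_nonneg.2 h3) (sub_nonneg.2 huv),
      mul_nonneg (sub_nonneg.2 h3) (sub_nonneg.2 (h2.trans h4))]

lemma sum_sum_mul_mul_sub_sq {κ : Type*} [Fintype κ] {a : κ → ℝ} (ha : ∑ j, a j = 1)
    (x : κ → ℝ) :
    ∑ j, ∑ k, a j * a k * (x j - x k) ^ 2
      = 2 * ∑ j, a j * x j ^ 2 - 2 * (∑ j, a j * x j) ^ 2 := by
  have h : ∀ j k, a j * a k * (x j - x k) ^ 2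
      = a j * x j ^ 2 * a k + a j * (a k * x k ^ 2) - 2 * (a j * x j) * (a k * x k) := by
    intros; ring
  simp only [h, Finset.sum_sub_distrib, Finset.sum_add_distrib, ← Finset.mul_sum,
    ← Finset.sum_mul, ha]
  ring

lemma IsDoublyStochastic.sum_sq_sub_sum_sq {n : ℕ} {A : Matrix (Fin n) (Fin n) ℝ}
    (hA : IsDoublyStochastic A) (x : Fin n → ℝ) :
    ∑ i, x i ^ 2 - ∑ i, (∑ j, A i j * x j) ^ 2
      = (1 / 2) * ∑ i, ∑ j, ∑ k, A i j * A i k * (x j - x k) ^ 2 := by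
  have h1 : ∑ i, ∑ j, A i j * x j ^ 2 = ∑ j, x j ^ 2 := by
    rw [Finset.sum_comm]
    exact Finset.sum_congr rfl fun j _ => by rw [← Finset.sum_mul, hA.2.2 j, one_mul]
  simp only [fun i => sum_sum_mul_mul_sub_sq (hA.2.1 i) x, Finset.sum_sub_distrib,
    ← Finset.mul_sum, h1]
  ring

lemma IsDoublyStochastic.sum_sq_le {n : ℕ} {A : Matrix (Fin n) (Fin n) ℝ}
    (hA : IsDoublyStochastic A) (x : Fin n → ℝ) :
    ∑ i, (∑ j, A i j * x j) ^ 2 ≤ ∑ i, x i ^ 2 := by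
  have h := hA.sum_sq_sub_sum_sq x
  have : 0 ≤ ∑ i, ∑ j, ∑ k, A i j * A i k * (x j - x k) ^ 2 :=
    Finset.sum_nonneg fun i _ => Finset.sum_nonneg fun j _ => Finset.sum_nonneg fun k _ =>
      mul_nonneg (mul_nonneg (hA.1 i j) (hA.1 i k)) (sq_nonneg _)
  linarith

lemma sum_sum_mul_separated {κ : Type*} [Fintype κ] [DecidableEq κ] {a : κ → ℝ}
    (ha : ∑ j, a j = 1) (S : Finset κ) :
    ∑ j, ∑ k, a j * a k * (if (j ∈ S ↔ k ∈ S) then (0 : ℝ) else 1)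
      = 2 * ((∑ j ∈ S, a j) * (1 - ∑ j ∈ S, a j)) := by
  have h := sum_sum_mul_mul_sub_sq ha fun j => if j ∈ S then (1 : ℝ) else 0
  have h2 : ∑ j, ∑ k, a j * a k * (if (j ∈ S ↔ k ∈ S) then (0 : ℝ) else 1)
      = ∑ j, ∑ k, a j * a k * ((if j ∈ S then (1 : ℝ) else 0) - if k ∈ S then 1 else 0) ^ 2 := by
    refine Finset.sum_congr rfl fun j _ => Finset.sum_congr rfl fun k _ => ?_
    by_cases hj : j ∈ S <;> by_cases hk : k ∈ S <;> simp [hj, hk]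
  rw [h2, h]
  simp
  ring

lemma Crosses.half_le {n : ℕ} {A : Matrix (Fin n) (Fin n) ℝ} {η : ℝ}
    (hA : IsDoublyStochastic A) (hdiag : ∀ i, 0 < A i i) (hη : ∀ i j, 0 < A i j → η ≤ A i j)
    {S : Finset (Fin n)} (hS : Crosses A S) :
    η / 2 ≤ ∑ i, (∑ j ∈ S, A i j) * (1 - ∑ j ∈ S, A i j) := by
  have hcompl : ∀ i, 1 - ∑ j ∈ S, A i j = ∑ j ∈ Sᶜ, A i j := fun i => by
    rw [← hA.2.1 i, ← Finset.sum_add_sum_compl S]; ring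
  have hmem : ∀ (T : Finset (Fin n)) i j, j ∈ T → 0 < A i j → η ≤ ∑ j ∈ T, A i j :=
    fun T i j hj hp => (hη i j hp).trans
      (Finset.single_le_sum (f := fun j => A i j) (fun k _ => hA.1 i k) hj)
  obtain ⟨i, j, hij, hsep⟩ := hS
  have hterm : (∑ j ∈ S, A i j) * (1 - ∑ j ∈ S, A i j)
      ≤ ∑ i, (∑ j ∈ S, A i j) * (1 - ∑ j ∈ S, A i j) := by
    refine Finset.single_le_sum (f := fun i => (∑ j ∈ S, A i j) * (1 - ∑ j ∈ S, A i j))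
      (fun k _ => ?_) (Finset.mem_univ i)
    simp only [hcompl]
    exact mul_nonneg (Finset.sum_nonneg fun l _ => hA.1 k l)
      (Finset.sum_nonneg fun l _ => hA.1 k l)
  have hC : η ≤ ∑ j ∈ S, A i j ∧ η ≤ 1 - ∑ j ∈ S, A i j := by
    rw [hcompl]
    by_cases hi : i ∈ S
    · have hj : j ∉ S := by tauto
      exact ⟨hmem S i i hi (hdiag i), hmem _ i j (Finset.mem_compl.2 hj) hij⟩
    · have hj : j ∈ S := by tauto
      exact ⟨hmem S i j hj hij, hmem _ i i (Finset.mem_compl.2 hi) (hdiag i)⟩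
  refine le_trans ?_ hterm
  have hpos : 0 ≤ (∑ j ∈ S, A i j) * (1 - ∑ j ∈ S, A i j) := by
    rw [hcompl]
    exact mul_nonneg (Finset.sum_nonneg fun l _ => hA.1 i l)
      (Finset.sum_nonneg fun l _ => hA.1 i l)
  obtain ⟨h1, h2⟩ := hC
  rcases le_or_gt η 0 with h0 | h0
  · linarith
  · nlinarith [mul_nonneg (sub_nonneg.2 h1) (sub_nonneg.2 h2)]

/-- One averaging step dissipates at least `η / 2` times the squared gap of every cut it crosses. -/
lemma IsDoublyStochastic.gap_dissipation {n : ℕ} {ι : Type*} [LinearOrder ι]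
    {A : Matrix (Fin n) (Fin n) ℝ} {η : ℝ}
    (hA : IsDoublyStochastic A) (hdiag : ∀ i, 0 < A i i) (hη : ∀ i j, 0 < A i j → η ≤ A i j)
    {lo hi : ι → ℝ} (hle : ∀ d, lo d ≤ hi d) (hlt : ∀ d d', d < d' → hi d ≤ lo d')
    {S : ι → Finset (Fin n)} {x : Fin n → ℝ} {D : Finset ι}
    (hlo : ∀ d ∈ D, ∀ i ∈ S d, x i ≤ lo d) (hhi : ∀ d ∈ D, ∀ i ∉ S d, hi d ≤ x i)
    (hD : ∀ d ∈ D, Crosses A (S d)) :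
    η / 2 * ∑ d ∈ D, (hi d - lo d) ^ 2 + ∑ i, (∑ j, A i j * x j) ^ 2 ≤ ∑ i, x i ^ 2 := by
  have hpair : ∀ j k, ∑ d ∈ D, (hi d - lo d) ^ 2 * (if (j ∈ S d ↔ k ∈ S d) then (0 : ℝ) else 1)
      ≤ (x j - x k) ^ 2 := by
    intro j k
    have h := sum_sq_gap_le hle hlt (D.filter fun d => ¬(j ∈ S d ↔ k ∈ S d))
      (u := min (x j) (x k)) (v := max (x j) (x k)) min_le_max ?_ ?_
    · rw [max_sub_min_eq_abs, sq_abs, Finset.sum_filter] at h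
      refine le_trans (le_of_eq (Finset.sum_congr rfl fun d _ => ?_)) (h.trans (by nlinarith))
      split_ifs <;> simp_all
    · intro d hd
      obtain ⟨hdD, hs⟩ := Finset.mem_filter.1 hd
      by_cases hj : j ∈ S d
      · exact (min_le_left _ _).trans (hlo d hdD j hj)
      · exact (min_le_right _ _).trans (hlo d hdD k (by tauto))
    · intro d hd
      obtain ⟨hdD, hs⟩ := Finset.mem_filter.1 hd
      by_cases hj : j ∈ S d
      · exact (hhi d hdD k (by tauto)).trans (le_max_right _ _)
      · exact (hhi d hdD j hj).trans (le_max_left _ _)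
  have hsum : ∑ i, ∑ j, ∑ k, A i j * A i k *
        ∑ d ∈ D, (hi d - lo d) ^ 2 * (if (j ∈ S d ↔ k ∈ S d) then (0 : ℝ) else 1)
      ≤ ∑ i, ∑ j, ∑ k, A i j * A i k * (x j - x k) ^ 2 :=
    Finset.sum_le_sum fun i _ => Finset.sum_le_sum fun j _ => Finset.sum_le_sum fun k _ =>
      mul_le_mul_of_nonneg_left (hpair j k) (mul_nonneg (hA.1 i j) (hA.1 i k))
  have hswap : ∑ i, ∑ j, ∑ k, A i j * A i k *
        ∑ d ∈ D, (hi d - lo d) ^ 2 * (if (j ∈ S d ↔ k ∈ S d) then (0 : ℝ) else 1)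
      = ∑ d ∈ D, (hi d - lo d) ^ 2 *
          (2 * ∑ i, (∑ j ∈ S d, A i j) * (1 - ∑ j ∈ S d, A i j)) := by
    simp only [Finset.mul_sum (s := Finset.univ) (a := (2 : ℝ)),
      ← fun d i => sum_sum_mul_separated (hA.2.1 i) (S d)]
    simp only [Finset.mul_sum]
    simp only [Finset.sum_comm (t := D)]
    refine Finset.sum_congr rfl fun d _ => Finset.sum_congr rfl fun i _ =>
      Finset.sum_congr rfl fun j _ => Finset.sum_congr rfl fun k _ => ?_
    ring
  have hlow : η * ∑ d ∈ D, (hi d - lo d) ^ 2 ≤ ∑ d ∈ D, (hi d - lo d) ^ 2 *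
          (2 * ∑ i, (∑ j ∈ S d, A i j) * (1 - ∑ j ∈ S d, A i j)) := by
    rw [Finset.mul_sum]
    refine Finset.sum_le_sum fun d hd => ?_
    have := (hD d hd).half_le hA hdiag hη
    nlinarith [sq_nonneg (hi d - lo d)]
  have := hA.sum_sq_sub_sum_sq x
  linarith

/-- A family of nested cuts that have all been crossed by time `T` forces a decrease of the sum of
squares. -/
lemma gap_dissipation_of_crosses {n : ℕ} {ι : Type*} [LinearOrder ι] [Fintype ι]
    {A : ℕ → Matrix (Fin n) (Fin n) ℝ} {η : ℝ} (hA : WeightsAssumption A η)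
    {lo hi : ι → ℝ} (hle : ∀ d, lo d ≤ hi d) (hlt : ∀ d d', d < d' → hi d ≤ lo d')
    {S : ι → Finset (Fin n)} {x : ℕ → Fin n → ℝ}
    (hx : ∀ t i, x (t + 1) i = ∑ j, A t i j * x t j)
    (hlo : ∀ d, ∀ i ∈ S d, x 0 i ≤ lo d) (hhi : ∀ d, ∀ i ∉ S d, hi d ≤ x 0 i)
    {T : ℕ} (hT : ∀ d, ∃ t < T, Crosses (A t) (S d)) :
    η / 2 * ∑ d, (hi d - lo d) ^ 2 + ∑ i, x T i ^ 2 ≤ ∑ i, x 0 i ^ 2 := by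
  classical
  have hstay : ∀ d t, (∀ s < t, ¬Crosses (A s) (S d)) →
      (∀ i ∈ S d, x t i ≤ lo d) ∧ (∀ i ∉ S d, hi d ≤ x t i) := by
    intro d t
    induction t with
    | zero => exact fun _ => ⟨hlo d, hhi d⟩
    | succ t ih =>
      intro h
      obtain ⟨h1, h2⟩ := ih fun s hs => h s (by omega)
      have hDS := (hA.2 t).1
      have hzero : ∀ i j, ¬(i ∈ S d ↔ j ∈ S d) → A t i j = 0 := fun i j hij =>
        le_antisymm (not_lt.1 fun hp => h t (by omega) ⟨i, j, hp, hij⟩) (hDS.1 i j)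
      constructor
      · intro i hi'
        rw [hx, ← one_mul (lo d), ← hDS.2.1 i, Finset.sum_mul]
        refine Finset.sum_le_sum fun j _ => ?_
        by_cases hj : j ∈ S d
        · exact mul_le_mul_of_nonneg_left (h1 j hj) (hDS.1 i j)
        · simp [hzero i j (by tauto)]
      · intro i hi'
        rw [hx, ← one_mul (hi d), ← hDS.2.1 i, Finset.sum_mul]
        refine Finset.sum_le_sum fun j _ => ?_
        by_cases hj : j ∈ S d
        · simp [hzero i j (by tauto)]
        · exact mul_le_mul_of_nonneg_left (h2 j hj) (hDS.1 i j)
  have key : ∀ t, η / 2 * ∑ d with ∃ s < t, Crosses (A s) (S d), (hi d - lo d) ^ 2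
      + ∑ i, x t i ^ 2 ≤ ∑ i, x 0 i ^ 2 := by
    intro t
    induction t with
    | zero => simp
    | succ t ih =>
      have hstep := (hA.2 t).1.gap_dissipation (hA.2 t).2.1 (hA.2 t).2.2 hle hlt (x := x t)
        (D := Finset.univ.filter fun d =>
          Crosses (A t) (S d) ∧ ¬∃ s < t, Crosses (A s) (S d))
        (fun d hd => (hstay d t fun s hs hc => (Finset.mem_filter.1 hd).2.2 ⟨s, hs, hc⟩).1)
        (fun d hd => (hstay d t fun s hs hc => (Finset.mem_filter.1 hd).2.2 ⟨s, hs, hc⟩).2)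
        (fun d hd => (Finset.mem_filter.1 hd).2.1)
      have hsplit : ∑ d with ∃ s < t + 1, Crosses (A s) (S d), (hi d - lo d) ^ 2
          = ∑ d with ∃ s < t, Crosses (A s) (S d), (hi d - lo d) ^ 2
            + ∑ d with Crosses (A t) (S d) ∧ ¬∃ s < t, Crosses (A s) (S d),
                (hi d - lo d) ^ 2 := by
        rw [← Finset.sum_union]
        · refine Finset.sum_congr ?_ fun _ _ => rfl
          ext d
          simp only [Finset.mem_filter, Finset.mem_univ, true_and, Finset.mem_union,
            Nat.lt_succ_iff_lt_or_eq, or_and_right, exists_or, exists_eq_left]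
          by_cases h : ∃ s < t, Crosses (A s) (S d)
          · simp only [h, true_or]
          · simp only [h, false_or, not_false_eq_true, and_true]
        · exact Finset.disjoint_filter.2 fun d _ h h' => h'.2 h
      rw [hsplit, mul_add]
      simp only [← hx] at hstep
      linarith
  have h := key T
  rwa [Finset.filter_true_of_mem fun d _ => hT d] at h

lemma sum_sq_le_card_sq_mul_sum_gap_sq {N : ℕ} {s : Fin (N + 1) → ℝ} (hs : Monotone s)
    (h0 : ∑ i, s i = 0) :
    ∑ i, s i ^ 2 ≤ ((N + 1 : ℕ) : ℝ) ^ 2 * ∑ d : Fin N, (s d.succ - s d.castSucc) ^ 2 := by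
  have hfirst : s 0 ≤ 0 := by
    by_contra! h
    have : 0 < ∑ i, s i := Finset.sum_pos (fun i _ => h.trans_le (hs (Fin.zero_le i))) (by simp)
    linarith
  have hlast : 0 ≤ s (Fin.last N) := by
    by_contra! h
    have : ∑ i, s i < 0 :=
      Finset.sum_neg (fun i _ => (hs (Fin.le_last i)).trans_lt h) (by simp)
    linarith
  have htel : ∑ d : Fin N, (s d.succ - s d.castSucc) = s (Fin.last N) - s 0 := by
    have h1 := Fin.sum_univ_succ s
    have h2 := Fin.sum_univ_castSucc s
    rw [Finset.sum_sub_distrib]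
    linarith
  have hcs := sq_sum_le_card_mul_sum_sq (s := (Finset.univ : Finset (Fin N)))
    (f := fun d => s d.succ - s d.castSucc)
  rw [htel, Finset.card_univ, Fintype.card_fin] at hcs
  have hi : ∀ i ∈ Finset.univ, s i ^ 2 ≤ (s (Fin.last N) - s 0) ^ 2 := by
    intro i _
    have h1 := hs (Fin.zero_le i)
    have h2 := hs (Fin.le_last i)
    exact sq_le_sq' (by linarith) (by linarith)
  have hsum := Finset.sum_le_card_nsmul _ _ _ hi
  rw [Finset.card_univ, Fintype.card_fin, nsmul_eq_mul] at hsum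
  have hG : 0 ≤ ∑ d : Fin N, (s d.succ - s d.castSucc) ^ 2 :=
    Finset.sum_nonneg fun _ _ => sq_nonneg _
  push_cast at hsum ⊢
  have hN : (0 : ℝ) ≤ N := N.cast_nonneg
  nlinarith [mul_le_mul_of_nonneg_left hcs (by linarith : (0 : ℝ) ≤ N + 1)]

/-- If every nontrivial cut is crossed by time `T`, the sum of squares of a zero-mean state has
contracted by `1 - η / (2 n²)`. -/
lemma sum_sq_contraction {n : ℕ} {A : ℕ → Matrix (Fin n) (Fin n) ℝ} {η : ℝ}
    (hA : WeightsAssumption A η) {T : ℕ}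
    (hT : ∀ S : Finset (Fin n), S.Nonempty → Sᶜ.Nonempty → ∃ t < T, Crosses (A t) S)
    {x : ℕ → Fin n → ℝ} (hx : ∀ t i, x (t + 1) i = ∑ j, A t i j * x t j)
    (h0 : ∑ i, x 0 i = 0) :
    ∑ i, x T i ^ 2 ≤ (1 - η / (2 * (n : ℝ) ^ 2)) * ∑ i, x 0 i ^ 2 := by
  rcases n with _ | N
  · simp
  set σ := Tuple.sort (x 0)
  have hσ : Monotone (x 0 ∘ σ) := Tuple.monotone_sort (x 0)
  have hgap := gap_dissipation_of_crosses hA (ι := Fin N)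
    (lo := fun d => x 0 (σ d.castSucc)) (hi := fun d => x 0 (σ d.succ))
    (S := fun d => Finset.univ.filter fun i => σ.symm i ≤ d.castSucc)
    (fun d => hσ (Fin.castSucc_lt_succ).le)
    (fun d d' h => hσ (Fin.succ_le_castSucc_iff.2 h)) hx
    (fun d i hi => by simpa using hσ (Finset.mem_filter.1 hi).2)
    (fun d i hi => by
      have : d.succ ≤ σ.symm i := by
        simpa [Fin.castSucc_lt_iff_succ_le] using hi
      simpa using hσ this)
    (T := T) (fun d => hT _ ⟨σ d.castSucc, by simp⟩
      ⟨σ d.succ, by simp⟩)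
  have hspread := sum_sq_le_card_sq_mul_sum_gap_sq hσ
    (by rw [← h0]; exact Equiv.sum_comp σ (x 0))
  have hperm : ∑ i, (x 0 ∘ σ) i ^ 2 = ∑ i, x 0 i ^ 2 :=
    Equiv.sum_comp σ fun i => x 0 i ^ 2
  rw [hperm] at hspread
  simp only [Function.comp_apply] at hspread
  have hn : (0 : ℝ) < ((N + 1 : ℕ) : ℝ) ^ 2 := by positivity
  have : η / (2 * ((N + 1 : ℕ) : ℝ) ^ 2) * ∑ i, x 0 i ^ 2
      ≤ η / 2 * ∑ d : Fin N, (x 0 (σ d.succ) - x 0 (σ d.castSucc)) ^ 2 := by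
    have hη := hA.1
    refine (mul_le_mul_of_nonneg_left hspread (by positivity)).trans (le_of_eq ?_)
    field_simp
  linarith

lemma ConnectivityAssumption.exists_crosses {n : ℕ} {A : ℕ → Matrix (Fin n) (Fin n) ℝ} {B : ℕ}
    (h : ConnectivityAssumption A B) (k : ℕ) (S : Finset (Fin n)) (hS : S.Nonempty)
    (hSc : Sᶜ.Nonempty) : ∃ t < B, Crosses (A (k * B + t)) S := by
  obtain ⟨u, hu⟩ := hS
  obtain ⟨v, hv⟩ := hSc
  rw [Finset.mem_compl] at hv
  by_contra! hno
  refine hv ?_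
  have hpath := h.2 k u v
  induction hpath with
  | refl => exact hu
  | @tail b c _ hbc ih =>
    obtain ⟨t, ht1, ht2, hpos⟩ := hbc
    by_contra hc
    refine hno (t - k * B) (by rw [add_mul] at ht2; omega) ?_
    rw [Nat.add_sub_cancel' ht1]
    exact ⟨c, b, hpos, by tauto⟩

open WithLp (toLp)

/-- The joint state of `n` agents in `ℝ^m`, with the Euclidean norm. -/
abbrev JointState (n m : ℕ) : Type := PiLp 2 fun _ : Fin n => EuclideanSpace ℝ (Fin m)

/-- One averaging step with weights `A`. -/
def mixStep {n m : ℕ} (A : Matrix (Fin n) (Fin n) ℝ) (v : JointState n m) : JointState n m :=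
  toLp 2 fun i => ∑ j, A i j • v j

/-- The deviation of the joint state from its mean. -/
noncomputable def meanDeviation {n m : ℕ} (v : JointState n m) : JointState n m :=
  toLp 2 fun i => v i - (1 / (n : ℝ)) • ∑ j, v j

lemma mixStep_sub {n m : ℕ} (A : Matrix (Fin n) (Fin n) ℝ) (v w : JointState n m) :
    mixStep A (v - w) = mixStep A v - mixStep A w := by
  ext1 i
  simp [mixStep, smul_sub, Finset.sum_sub_distrib]

lemma JointState.norm_sq_eq {n m : ℕ} (v : JointState n m) :
    ‖v‖ ^ 2 = ∑ c, ∑ i, v i c ^ 2 := by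
  rw [PiLp.norm_sq_eq_of_L2, Finset.sum_comm]
  exact Finset.sum_congr rfl fun i _ => EuclideanSpace.real_norm_sq_eq (v i)

lemma mixStep_apply {n m : ℕ} (A : Matrix (Fin n) (Fin n) ℝ) (v : JointState n m) (i : Fin n)
    (c : Fin m) : mixStep A v i c = ∑ j, A i j * v j c := by
  simp [mixStep]

lemma norm_mixStep_le {n m : ℕ} {A : Matrix (Fin n) (Fin n) ℝ} (hA : IsDoublyStochastic A)
    (v : JointState n m) : ‖mixStep A v‖ ≤ ‖v‖ := by
  refine le_of_sq_le_sq ?_ (norm_nonneg _)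
  simp only [JointState.norm_sq_eq, mixStep_apply]
  exact Finset.sum_le_sum fun c _ => hA.sum_sq_le fun i => v i c

lemma sum_meanDeviation {n m : ℕ} (v : JointState n m) : ∑ i, meanDeviation v i = 0 := by
  rcases n with _ | n
  · simp
  · simp only [meanDeviation, Finset.sum_sub_distrib, Finset.sum_const, Finset.card_univ,
      Fintype.card_fin, ← Nat.cast_smul_eq_nsmul ℝ, smul_smul]
    rw [mul_one_div_cancel (by positivity), one_smul, sub_self]

lemma norm_meanDeviation_le {n m : ℕ} (v : JointState n m) : ‖meanDeviation v‖ ≤ ‖v‖ := by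
  refine le_of_sq_le_sq ?_ (norm_nonneg _)
  set μ := (1 / (n : ℝ)) • ∑ j, v j
  have h : ∀ i, ‖v i‖ ^ 2 = ‖meanDeviation v i‖ ^ 2 + 2 * ⟪meanDeviation v i, μ⟫ + ‖μ‖ ^ 2 := by
    intro i
    rw [← norm_add_sq_real]
    simp [meanDeviation, μ]
  rw [PiLp.norm_sq_eq_of_L2, PiLp.norm_sq_eq_of_L2]
  simp only [h, Finset.sum_add_distrib, ← Finset.mul_sum, ← sum_inner, sum_meanDeviation,
    inner_zero_left]
  have : 0 ≤ ∑ _i : Fin n, ‖μ‖ ^ 2 := Finset.sum_nonneg fun _ _ => sq_nonneg _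
  linarith

lemma sum_mixStep {n m : ℕ} {A : Matrix (Fin n) (Fin n) ℝ} (hA : IsDoublyStochastic A)
    (v : JointState n m) : ∑ i, mixStep A v i = ∑ i, v i := by
  simp only [mixStep]
  rw [Finset.sum_comm]
  exact Finset.sum_congr rfl fun j _ => by rw [← Finset.sum_smul, hA.2.2 j, one_smul]

lemma meanDeviation_mixStep_sub {n m : ℕ} {A : Matrix (Fin n) (Fin n) ℝ}
    (hA : IsDoublyStochastic A) (v w : JointState n m) :
    meanDeviation (mixStep A v - w) = mixStep A (meanDeviation v) - meanDeviation w := by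
  ext1 i
  have h : mixStep A (meanDeviation v) i = mixStep A v i - (1 / (n : ℝ)) • ∑ j, v j := by
    simp only [mixStep, meanDeviation, smul_sub, Finset.sum_sub_distrib, ← Finset.sum_smul,
      hA.2.1 i, one_smul]
  have h2 : ∑ j, (mixStep A v - w) j = ∑ j, v j - ∑ j, w j := by
    simp only [PiLp.sub_apply, Finset.sum_sub_distrib, sum_mixStep hA]
  rw [PiLp.sub_apply, h]
  change (mixStep A v - w) i - (1 / (n : ℝ)) • ∑ j, (mixStep A v - w) j
    = _ - (w i - (1 / (n : ℝ)) • ∑ j, w j)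
  rw [h2, PiLp.sub_apply, smul_sub]
  abel

lemma norm_le_sqrt_card_mul {n m : ℕ} {v : JointState n m} {C : ℝ} (h : ∀ i, ‖v i‖ ≤ C)
    (hC : 0 ≤ C) : ‖v‖ ≤ √n * C := by
  refine le_of_sq_le_sq ?_ (by positivity)
  rw [PiLp.norm_sq_eq_of_L2, mul_pow, Real.sq_sqrt n.cast_nonneg]
  refine (Finset.sum_le_card_nsmul _ _ (C ^ 2) fun i _ =>
    pow_le_pow_left₀ (norm_nonneg _) (h i) 2).trans ?_
  simp

/-- The block contraction for zero-mean joint states. -/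
lemma norm_contraction {n m : ℕ} {A : ℕ → Matrix (Fin n) (Fin n) ℝ} {η : ℝ}
    (hA : WeightsAssumption A η) {T : ℕ}
    (hT : ∀ S : Finset (Fin n), S.Nonempty → Sᶜ.Nonempty → ∃ t < T, Crosses (A t) S)
    {p : ℕ → JointState n m} (hp : ∀ t, p (t + 1) = mixStep (A t) (p t))
    (h0 : ∑ i, p 0 i = 0) {β : ℝ} (hβ : β = 1 - η / (4 * (n : ℝ) ^ 2)) (hβ0 : 0 ≤ β) :
    ‖p T‖ ≤ β * ‖p 0‖ := by
  refine le_of_sq_le_sq ?_ (by positivity)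
  have hc : ∀ c, ∑ i, p T i c ^ 2 ≤ (1 - η / (2 * (n : ℝ) ^ 2)) * ∑ i, p 0 i c ^ 2 := fun c =>
    sum_sq_contraction hA hT (x := fun t i => p t i c)
      (fun t i => by simp only [hp, mixStep_apply])
      (by simpa using congrArg (fun v : EuclideanSpace ℝ (Fin m) => v c) h0)
  have hβ2 : 1 - η / (2 * (n : ℝ) ^ 2) ≤ β ^ 2 := by
    have : η / (2 * (n : ℝ) ^ 2) = 2 * (η / (4 * (n : ℝ) ^ 2)) := by ring
    rw [this, hβ]
    nlinarith [sq_nonneg (η / (4 * (n : ℝ) ^ 2))]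
  rw [mul_pow]
  refine le_trans ?_ (mul_le_mul_of_nonneg_right hβ2 (sq_nonneg _))
  rw [JointState.norm_sq_eq, JointState.norm_sq_eq, Finset.mul_sum]
  exact Finset.sum_le_sum fun c _ => hc c

/-- Perturbed averaging of zero-mean states stays bounded under bounded perturbations. -/
lemma norm_perturbed_mix_le {n m : ℕ} {A : ℕ → Matrix (Fin n) (Fin n) ℝ} {η : ℝ} {B : ℕ}
    (hA : WeightsAssumption A η) (hConn : ConnectivityAssumption A B)
    {z w : ℕ → JointState n m} (hz : ∀ k, z (k + 1) = mixStep (A k) (z k) - w k)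
    (hzero : ∀ k, ∑ i, z k i = 0) {D : ℝ} (hz0 : ‖z 0‖ ≤ D) (hw : ∀ k, ‖w k‖ ≤ D)
    {β : ℝ} (hβ : β = 1 - η / (4 * (n : ℝ) ^ 2)) (hβ0 : 0 ≤ β) (hβ1 : β < 1) (k : ℕ) :
    ‖z k‖ ≤ 2 * (D * B / (1 - β)) := by
  have hD : 0 ≤ D := (norm_nonneg _).trans hz0
  have hB : (1 : ℝ) ≤ B := by exact_mod_cast hConn.1
  have hlow : D * B ≤ D * B / (1 - β) :=
    le_div_self (by positivity) (by linarith) (by linarith)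
  have hnext : ∀ k, ‖z (k + 1)‖ ≤ ‖z k‖ + D := fun k => by
    rw [hz]
    exact (norm_sub_le _ _).trans (add_le_add (norm_mixStep_le (hA.2 k).1 _) (hw k))
  have hwithin : ∀ k t, ‖z (k + t)‖ ≤ ‖z k‖ + t * D := by
    intro k t
    induction t with
    | zero => simp
    | succ t ih =>
      have := hnext (k + t)
      rw [← add_assoc]
      push_cast
      linarith
  have hblock : ∀ b, ‖z ((b + 1) * B)‖ ≤ β * ‖z (b * B)‖ + B * D := by
    intro b
    let p : ℕ → JointState n m :=
      fun t => Nat.rec (z (b * B)) (fun t v => mixStep (A (b * B + t)) v) t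
    have hp : ∀ t, p (t + 1) = mixStep (A (b * B + t)) (p t) := fun _ => rfl
    have hdist : ∀ t, ‖z (b * B + t) - p t‖ ≤ t * D := by
      intro t
      induction t with
      | zero => simp [p]
      | succ t ih =>
        rw [← add_assoc, hz, hp, sub_right_comm, ← mixStep_sub]
        have h1 := norm_sub_le (mixStep (A (b * B + t)) (z (b * B + t) - p t)) (w (b * B + t))
        have h2 := norm_mixStep_le (hA.2 (b * B + t)).1 (z (b * B + t) - p t)
        have h3 := hw (b * B + t)
        push_cast
        linarith
    have hcontr : ‖p B‖ ≤ β * ‖p 0‖ :=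
      norm_contraction (A := fun t => A (b * B + t)) ⟨hA.1, fun t => hA.2 (b * B + t)⟩
        (hConn.exists_crosses b) hp (hzero _) hβ hβ0
    have h1 := hdist B
    have h2 := norm_sub_norm_le (z (b * B + B)) (p B)
    have h3 : p 0 = z (b * B) := rfl
    rw [h3] at hcontr
    rw [add_mul, one_mul]
    linarith
  have hstart : ∀ b, ‖z (b * B)‖ ≤ D * B / (1 - β) := by
    intro b
    induction b with
    | zero =>
      rw [zero_mul]
      nlinarith
    | succ b ih =>
      have h1 := mul_le_mul_of_nonneg_left ih hβ0
      have h2 : D * B / (1 - β) = β * (D * B / (1 - β)) + B * D := by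
        have : 1 - β ≠ 0 := by linarith
        field_simp
        ring
      linarith [hblock b]
  have h1 := hwithin (k / B * B) (k % B)
  rw [Nat.div_add_mod'] at h1
  have h2 : ((k % B : ℕ) : ℝ) ≤ B := by exact_mod_cast (Nat.mod_lt k hConn.1).le
  nlinarith [hstart (k / B)]

lemma norm_quantization_error_le {m Q : ℕ} (hQ : 0 < Q) {v q : EuclideanSpace ℝ (Fin m)}
    (hq : ∀ c, q c = ⌊(Q : ℝ) * v c⌋ / Q) : ‖v - q‖ ≤ √m / Q := by
  have hQ' : (0 : ℝ) < Q := by exact_mod_cast hQ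
  refine le_of_sq_le_sq ?_ (by positivity)
  rw [EuclideanSpace.real_norm_sq_eq, div_pow, Real.sq_sqrt m.cast_nonneg]
  have hc : ∀ c ∈ Finset.univ, (v - q) c ^ 2 ≤ 1 / (Q : ℝ) ^ 2 := by
    intro c _
    have h : (v - q) c = Int.fract ((Q : ℝ) * v c) / Q := by
      rw [PiLp.sub_apply, hq, Int.fract]
      field_simp
    rw [h, div_pow]
    gcongr
    exact pow_le_one₀ (Int.fract_nonneg _) (Int.fract_lt_one _).le
  refine (Finset.sum_le_card_nsmul _ _ _ hc).trans (le_of_eq ?_)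
  simp [div_eq_mul_inv]

/-- Lemma 2(b): under Assumptions 1 and 2, bounded subgradients
(`‖g‖ ≤ L`) and `max_j ‖x_jQ(0)‖ ≤ αL`, the quantized iterates stay uniformly close to
the stopped-model limits: for every agent `i` and every `k`,
`‖x_iQ(k) − y(k)‖ ≤ 2(αL + √m/Q)(1 + nB/(β(1−β)))`, where `β = 1 − η/(4n²)`. -/
theorem quantized_iterates_close_to_limit
    (n m : ℕ) (hn : 1 ≤ n) (hm : 1 ≤ m)
    (A : ℕ → Matrix (Fin n) (Fin n) ℝ) (η : ℝ) (B : ℕ)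
    (hA : WeightsAssumption A η) (hConn : ConnectivityAssumption A B)
    (f : Fin n → EuclideanSpace ℝ (Fin m) → ℝ)
    (hf : ∀ i, ConvexOn ℝ Set.univ (f i))
    (Q : ℕ) (hQ : 0 < Q) (α : ℝ) (hα : 0 < α)
    (xQ d : ℕ → Fin n → EuclideanSpace ℝ (Fin m))
    (hd : ∀ k i, IsSubgradientAt (f i) (d k i) (xQ k i))
    (hq0 : ∀ (i : Fin n) (c : Fin m), ∃ z : ℤ, xQ 0 i c = (z : ℝ) / Q)
    (hup : ∀ (k : ℕ) (i : Fin n) (c : Fin m),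
      xQ (k + 1) i c = ⌊(Q : ℝ) * ((∑ j, A k i j • xQ k j - α • d k i) c)⌋ / Q)
    (e : ℕ → Fin n → EuclideanSpace ℝ (Fin m))
    (he : ∀ (k : ℕ) (i : Fin n),
      e (k + 1) i = ∑ j, A k i j • xQ k j - α • d k i - xQ (k + 1) i)
    (y : ℕ → EuclideanSpace ℝ (Fin m))
    (hy : ∀ k : ℕ, y k = (1 / (n : ℝ)) • ∑ j, xQ 0 j
        - (α / (n : ℝ)) • ∑ s ∈ Finset.Icc 1 k, ∑ j, d (s - 1) j
        - (1 / (n : ℝ)) • ∑ s ∈ Finset.Icc 1 k, ∑ j, e s j)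
    (L : ℝ) (hL : 0 < L)
    (hLb : ∀ (i : Fin n) (x g : EuclideanSpace ℝ (Fin m)),
      IsSubgradientAt (f i) g x → ‖g‖ ≤ L)
    (hx0 : ∀ i : Fin n, ‖xQ 0 i‖ ≤ α * L)
    (β : ℝ) (hβ : β = 1 - η / (4 * (n : ℝ) ^ 2)) :
    ∀ (i : Fin n) (k : ℕ),
      ‖xQ k i - y k‖ ≤
        2 * (α * L + Real.sqrt m / Q) * (1 + (n : ℝ) * B / (β * (1 - β))) := by
  have hη := hA.1
  have hn' : (1 : ℝ) ≤ n := by exact_mod_cast hn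
  have hη1 : η ≤ 1 := by
    have h := hA.2 0
    let i : Fin n := ⟨0, hn⟩
    exact (h.2.2 i i (h.2.1 i)).trans ((Finset.single_le_sum
      (fun j _ => h.1.1 i j) (Finset.mem_univ i)).trans (h.1.2.1 i).le)
  have hfrac : 0 < η / (4 * (n : ℝ) ^ 2) := by positivity
  have hfrac1 : η / (4 * (n : ℝ) ^ 2) < 1 := by
    rw [div_lt_one (by positivity)]
    nlinarith
  have hβ0 : 0 < β := by linarith
  have hβ1 : β < 1 := by linarith
  set C := α * L + √m / Q
  have hC : 0 ≤ C := by positivity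
  have hmean : ∀ k, y k = (1 / (n : ℝ)) • ∑ j, xQ k j := by
    intro k
    induction k with
    | zero => simp [hy]
    | succ k ih =>
      have hstep : y (k + 1) = y k - (α / (n : ℝ)) • ∑ j, d k j
          - (1 / (n : ℝ)) • ∑ j, e (k + 1) j := by
        rw [hy (k + 1), hy k, Finset.sum_Icc_succ_top (by omega),
          Finset.sum_Icc_succ_top (by omega), Nat.add_sub_cancel, smul_add, smul_add]
        abel
      have hsum : ∑ j, e (k + 1) j = ∑ j, xQ k j - α • ∑ j, d k j - ∑ j, xQ (k + 1) j := by
        have := sum_mixStep (hA.2 k).1 (toLp 2 (xQ k))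
        simp only [mixStep] at this
        simp only [he, Finset.sum_sub_distrib, this, Finset.smul_sum]
      rw [hstep, ih, hsum, smul_sub, smul_sub, smul_smul, one_div_mul_eq_div]
      abel
  let w : ℕ → JointState n m := fun k => toLp 2 fun i => α • d k i + e (k + 1) i
  have hw : ∀ k, ‖w k‖ ≤ √n * C := fun k => norm_le_sqrt_card_mul (fun i => by
    refine (norm_add_le _ _).trans (add_le_add ?_ ?_)
    · rw [norm_smul, Real.norm_of_nonneg hα.le]
      exact mul_le_mul_of_nonneg_left (hLb i _ _ (hd k i)) hα.le
    · rw [he]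
      exact norm_quantization_error_le hQ (hup k i)) hC
  have hrec : ∀ k, toLp 2 (xQ (k + 1)) = mixStep (A k) (toLp 2 (xQ k)) - w k := by
    intro k
    ext1 i
    simp only [mixStep, w, PiLp.sub_apply, he]
    abel
  have hx0C : ‖(toLp 2 (xQ 0) : JointState n m)‖ ≤ √n * C :=
    norm_le_sqrt_card_mul (fun i => (hx0 i).trans (le_add_of_nonneg_right (by positivity))) hC
  intro i k
  have hbound := norm_perturbed_mix_le hA hConn
    (z := fun k => meanDeviation (toLp 2 (xQ k))) (w := fun k => meanDeviation (w k))
    (fun k => by rw [hrec, meanDeviation_mixStep_sub (hA.2 k).1])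
    (fun k => sum_meanDeviation _) ((norm_meanDeviation_le _).trans hx0C)
    (fun k => (norm_meanDeviation_le _).trans (hw k)) hβ hβ0.le hβ1 k
  have hi : ‖xQ k i - y k‖ ≤ ‖(meanDeviation (toLp 2 (xQ k)) : JointState n m)‖ := by
    rw [hmean]
    exact PiLp.norm_apply_le (meanDeviation (toLp 2 (xQ k)) : JointState n m) i
  have hsqrt : √(n : ℝ) ≤ n := Real.sqrt_le_iff.2 ⟨by positivity, by nlinarith⟩
  have h1β : 0 < 1 - β := by linarith
  have hden : (n : ℝ) * B / (1 - β) ≤ n * B / (β * (1 - β)) := by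
    gcongr
    nlinarith
  calc ‖xQ k i - y k‖ ≤ 2 * (√n * C * B / (1 - β)) := hi.trans hbound
    _ ≤ 2 * (n * C * B / (1 - β)) := by gcongr
    _ = 2 * C * (n * B / (1 - β)) := by ring
    _ ≤ 2 * C * (1 + n * B / (β * (1 - β))) := by gcongr; linarith
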